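/- In the time-homogeneous stationary case (η_0 := η_∞), assume (H0) and (H). Then the pair (η_∞Q(1), h) is characterized as the unique pair (ζ, f), with ζ ∈ ℝ and f a bounded measurable function, such that Q(f) = ζ f and η_∞(f) = 1. Here Q(f) := G · M(f), and in particular η_∞(h) = 1 and Q(h) = η_∞(Q(1)) h. -/

import Mathlib

open MeasureTheory ProbabilityTheory Filter

noncomputable section

namespace FKCLT

variable {E : Type*} [MeasurableSpace E]

/-- Oscillation of a real-valued function. -/
def osc (f : E → ℝ) : ℝ := ⨆ p : E × E, |f p.1 - f p.2|

/-- Total variation distance between two (finite) measures. -/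
def tvDist (μ ν : Measure E) : ℝ := ⨆ s : Set E, |(μ s).toReal - (ν s).toReal|

/-- Normalization of a finite nonzero measure. -/
def normalize (μ : Measure E) : Measure E := (μ Set.univ)⁻¹ • μ

variable (M : ℕ → Kernel E E) (G : ℕ → E → ℝ)

/-- `Qmeas M G p n x` : the Feynman-Kac measure `A ↦ 𝔼[1_A(X_n) ∏_{p≤q<n} G_q(X_q) | X_p = x]`. -/
def Qmeas (p n : ℕ) (x : E) : Measure E :=
  if h : p < n then
    ENNReal.ofReal (G p x) • Measure.bind ((M (p + 1)) x) (fun z => Qmeas (p + 1) n z)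
  else Measure.dirac x
termination_by n - p
decreasing_by omega

/-- `Q_{p,n}(f)(x)`. -/
def Qop (p n : ℕ) (f : E → ℝ) (x : E) : ℝ := ∫ z, f z ∂(Qmeas M G p n x)

variable (η0 : Measure E)

/-- The normalized Feynman-Kac measure `η_n` (with the convention `η_{-1} := η_0`,
realized by `n - 1 = 0` in `ℕ` for `n = 0`). -/
def etaFK (n : ℕ) : Measure E := normalize (Measure.bind η0 (Qmeas M G 0 n))

/-- `Q̄_{p,n}(f) = Q_{p,n}(f) / η_p(Q_{p,n}(1))`. -/
def Qbar (p n : ℕ) (f : E → ℝ) (x : E) : ℝ :=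
  Qop M G p n f x / ∫ y, Qop M G p n (fun _ => 1) y ∂(etaFK M G η0 p)

/-- `d_{p,n}(f) = Q̄_{p,n}(f - η_n(f))`. -/
def dFK (p n : ℕ) (f : E → ℝ) (x : E) : ℝ :=
  Qbar M G η0 p n (fun z => f z - ∫ w, f w ∂(etaFK M G η0 n)) x

/-- `Ḡ_n = G_n / η_n(G_n)`. -/
def Gbar (n : ℕ) (x : E) : ℝ := G n x / ∫ z, G n z ∂(etaFK M G η0 n)

/-- `Φ_{p,n}(μ)`. -/
def PhiFK (p n : ℕ) (μ : Measure E) : Measure E := normalize (Measure.bind μ (Qmeas M G p n))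

/-- `Φ_n`, with the convention `Φ_0(μ) = η_0`. -/
def PhiStep (n : ℕ) (μ : Measure E) : Measure E :=
  if n = 0 then η0 else PhiFK M G (n - 1) n μ

/-- The Markov kernel `P_{p,n}(x, ·) = Q_{p,n}(x,·)/Q_{p,n}(1)(x)`. -/
def PFK (p n : ℕ) (x : E) : Measure E := normalize (Qmeas M G p n x)

/-- The covariance functional `Cov_{n,μ}(f1, f2)`. -/
def CovFn (K : ℕ → Measure E → Kernel E E) (n : ℕ) (μ : Measure E) (f1 f2 : E → ℝ) : ℝ :=
  ∫ x, ((∫ z, f1 z * f2 z ∂((K n μ) x)) -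
    (∫ z, f1 z ∂((K n μ) x)) * (∫ z, f2 z ∂((K n μ) x))) ∂μ

/-- `v_n = Σ_{0 ≤ q < n} Cov_{q, η_{q-1}}(Q̄_{q,n}(1), Q̄_{q,n}(1))`. -/
def vFK (K : ℕ → Measure E → Kernel E E) (n : ℕ) : ℝ :=
  ∑ q ∈ Finset.range n,
    CovFn K q (etaFK M G η0 (q - 1)) (Qbar M G η0 q n (fun _ => 1)) (Qbar M G η0 q n (fun _ => 1))

/-- Empirical measure of an `N`-tuple of points. -/
def empMeas {N : ℕ} (x : Fin N → E) : Measure E :=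
  (N : ENNReal)⁻¹ • ∑ i : Fin N, Measure.dirac (x i)

variable {Ω : Type*} [MeasurableSpace Ω]

/-- σ-algebra generated by the particle system up to time `n`. -/
def partFilt {N : ℕ} (ξ : ℕ → Ω → (Fin N → E)) (n : ℕ) : MeasurableSpace Ω :=
  ⨆ k ∈ Finset.range (n + 1), MeasurableSpace.comap (ξ k) inferInstance

/-- Local error fields `V_n^N`. -/
def VN {N : ℕ} (ξ : ℕ → Ω → (Fin N → E)) (n : ℕ) (f : E → ℝ) (ω : Ω) : ℝ :=
  Real.sqrt N * ((∫ z, f z ∂(empMeas (ξ n ω))) -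
    ∫ z, f z ∂(PhiStep M G η0 n (empMeas (ξ (n - 1) ω))))

/-- Global error fields `W_n^N`. -/
def WN {N : ℕ} (ξ : ℕ → Ω → (Fin N → E)) (n : ℕ) (f : E → ℝ) (ω : Ω) : ℝ :=
  Real.sqrt N * ((∫ z, f z ∂(empMeas (ξ n ω))) - ∫ z, f z ∂(etaFK M G η0 n))

/-- `L^m` norm of a real random variable. -/
def LmNorm (P : Measure Ω) (m : ℕ) (X : Ω → ℝ) : ℝ := (∫ ω, |X ω| ^ m ∂P) ^ ((m : ℝ)⁻¹)


/-- The one-step map Φ of a time-homogeneous model. -/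
def PhiHom (M1 : Kernel E E) (G1 : E → ℝ) (μ : Measure E) : Measure E :=
  PhiFK (fun _ => M1) (fun _ => G1) 0 1 μ

/-- The ground state function h, log h(x) = Σ_n [log Φ^n(δ_x)(G) - log Φ^n(η_∞)(G)]. -/
def hHom (M1 : Kernel E E) (G1 : E → ℝ) (ηinf : Measure E) (x : E) : ℝ :=
  Real.exp (∑' n : ℕ,
    (Real.log (∫ z, G1 z ∂((PhiHom M1 G1)^[n] (Measure.dirac x))) -
      Real.log (∫ z, G1 z ∂((PhiHom M1 G1)^[n] ηinf))))

section GroundState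

variable (κ : Kernel E E) (V : E → ℝ)

/-- The kernel `x ↦ V(x) κ(x, ·)`. -/
def potentialKernel (hV : Measurable V) : Kernel E E where
  toFun x := ENNReal.ofReal (V x) • κ x
  measurable' := by
    refine Measure.measurable_of_measurable_coe _ fun s hs => ?_
    simp only [Measure.smul_apply, smul_eq_mul]
    exact hV.ennreal_ofReal.mul (κ.measurable_coe hs)

variable {κ V}

lemma potentialKernel_apply (hV : Measurable V) (x : E) :
    potentialKernel κ V hV x = ENNReal.ofReal (V x) • κ x := rfl

lemma Qmeas_const_eq_pow (hV : Measurable V) (p n : ℕ) (x : E) :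
    Qmeas (fun _ => κ) (fun _ => V) p (p + n) x = (potentialKernel κ V hV ^ n) x := by
  induction n generalizing p x with
  | zero =>
    rw [Qmeas]
    simp only [add_zero, lt_self_iff_false, dite_false, pow_zero]
    exact (Kernel.id_apply x).symm
  | succ n ih =>
    have h : ∀ z, Qmeas (fun _ => κ) (fun _ => V) (p + 1) (p + (n + 1)) z
        = (potentialKernel κ V hV ^ n) z := fun z => by
      rw [← ih, show p + (n + 1) = p + 1 + n by ring]
    rw [Qmeas, dif_pos (by omega), pow_succ]
    change _ = ((potentialKernel κ V hV ^ n) ∘ₖ potentialKernel κ V hV) x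
    simp only [h]
    rw [Kernel.comp_apply, potentialKernel_apply, Measure.bind_smul]

lemma PFK_const_eq_normalize_pow (hV : Measurable V) (n : ℕ) (x : E) :
    PFK (fun _ => κ) (fun _ => V) 0 n x = normalize ((potentialKernel κ V hV ^ n) x) := by
  have h := Qmeas_const_eq_pow (κ := κ) hV 0 n x
  rw [zero_add] at h
  rw [PFK, h]

lemma PhiHom_eq_normalize_bind (hV : Measurable V) (μ : Measure E) :
    PhiHom κ V μ = normalize (μ.bind (potentialKernel κ V hV)) := by
  have h : Qmeas (fun _ => κ) (fun _ => V) 0 1 = potentialKernel κ V hV := by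
    ext1 x
    simpa using Qmeas_const_eq_pow (κ := κ) hV 0 1 x
  rw [PhiHom, PhiFK, h]

lemma normalize_smul (μ : Measure E) {r : ENNReal} (h0 : r ≠ 0) (ht : r ≠ ⊤) :
    normalize (r • μ) = normalize μ := by
  simp only [normalize, Measure.smul_apply, smul_eq_mul, smul_smul]
  congr 1
  rw [ENNReal.mul_inv (Or.inl h0) (Or.inl ht), mul_comm, ← mul_assoc, ENNReal.mul_inv_cancel h0 ht,
    one_mul]

lemma isProbabilityMeasure_normalize {μ : Measure E} [IsFiniteMeasure μ] (h : μ ≠ 0) :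
    IsProbabilityMeasure (normalize μ) := by
  constructor
  rw [normalize, Measure.smul_apply, smul_eq_mul]
  exact ENNReal.inv_mul_cancel (by simpa using h) (measure_ne_top _ _)

lemma integral_normalize (μ : Measure E) (f : E → ℝ) :
    ∫ x, f x ∂(normalize μ) = (μ.real Set.univ)⁻¹ * ∫ x, f x ∂μ := by
  rw [normalize, integral_smul_measure, ENNReal.toReal_inv, smul_eq_mul, measureReal_def]

lemma potentialKernel_univ [IsMarkovKernel κ] (hV : Measurable V) (x : E) :
    potentialKernel κ V hV x Set.univ = ENNReal.ofReal (V x) := by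
  simp [potentialKernel_apply]

lemma bind_potentialKernel_univ [IsMarkovKernel κ] (hV : Measurable V) (μ : Measure E) :
    (μ.bind (potentialKernel κ V hV)) Set.univ = ∫⁻ x, ENNReal.ofReal (V x) ∂μ := by
  rw [Measure.bind_apply MeasurableSet.univ (potentialKernel κ V hV).measurable.aemeasurable]
  simp_rw [potentialKernel_univ]

lemma integral_potentialKernel (hV : Measurable V) (hpos : ∀ x, 0 < V x) (f : E → ℝ) (x : E) :
    ∫ z, f z ∂(potentialKernel κ V hV x) = V x * ∫ z, f z ∂(κ x) := by
  rw [potentialKernel_apply, integral_smul_measure, ENNReal.toReal_ofReal (hpos x).le, smul_eq_mul]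

lemma isFiniteKernel_potentialKernel [IsMarkovKernel κ] (hV : Measurable V) {b : ℝ}
    (hb : ∀ x, V x ≤ b) : IsFiniteKernel (potentialKernel κ V hV) :=
  ⟨ENNReal.ofReal b, ENNReal.ofReal_lt_top, fun x => by
    rw [potentialKernel_univ]; exact ENNReal.ofReal_le_ofReal (hb x)⟩

lemma isFiniteKernel_pow (ρ : Kernel E E) [IsFiniteKernel ρ] (n : ℕ) : IsFiniteKernel (ρ ^ n) := by
  induction n with
  | zero => rw [pow_zero]; exact inferInstanceAs (IsFiniteKernel Kernel.id)
  | succ n ih => rw [pow_succ]; exact inferInstanceAs (IsFiniteKernel ((ρ ^ n) ∘ₖ ρ))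

lemma pow_succ_apply_eq_bind (ρ : Kernel E E) (n : ℕ) (x : E) :
    (ρ ^ (n + 1)) x = ((ρ ^ n) x).bind ρ := by
  rw [pow_succ']; exact Kernel.comp_apply ρ (ρ ^ n) x

lemma pow_succ_apply_eq_bind_pow (ρ : Kernel E E) (n : ℕ) (x : E) :
    (ρ ^ (n + 1)) x = (ρ x).bind (ρ ^ n) := by
  rw [pow_succ]; exact Kernel.comp_apply (ρ ^ n) ρ x

lemma bind_pow_succ (ρ : Kernel E E) (n : ℕ) (μ : Measure E) :
    μ.bind (ρ ^ (n + 1)) = (μ.bind (ρ ^ n)).bind ρ := by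
  rw [Measure.bind_bind (ρ ^ n).measurable.aemeasurable ρ.measurable.aemeasurable]
  simp_rw [← pow_succ_apply_eq_bind]

lemma lintegral_ofReal_ne_zero (hV : Measurable V) (hpos : ∀ x, 0 < V x) {μ : Measure E}
    (hμ : μ ≠ 0) : ∫⁻ x, ENNReal.ofReal (V x) ∂μ ≠ 0 := by
  rw [← pos_iff_ne_zero, lintegral_pos_iff_support hV.ennreal_ofReal]
  have : (Function.support fun x => ENNReal.ofReal (V x)) = Set.univ := by
    ext x; simp [hpos x]
  rw [this]
  simpa [pos_iff_ne_zero] using hμ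

lemma bind_potentialKernel_ne_zero [IsMarkovKernel κ] (hV : Measurable V) (hpos : ∀ x, 0 < V x)
    {μ : Measure E} (hμ : μ ≠ 0) : μ.bind (potentialKernel κ V hV) ≠ 0 := by
  intro h
  refine lintegral_ofReal_ne_zero hV hpos hμ ?_
  rw [← bind_potentialKernel_univ (κ := κ) hV, h]
  simp

lemma pow_potentialKernel_ne_zero [IsMarkovKernel κ] (hV : Measurable V) (hpos : ∀ x, 0 < V x)
    (n : ℕ) (x : E) : (potentialKernel κ V hV ^ n) x ≠ 0 := by
  induction n with
  | zero =>
    rw [pow_zero]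
    change Kernel.id x ≠ 0
    rw [Kernel.id_apply]
    exact IsProbabilityMeasure.ne_zero _
  | succ n ih =>
    rw [pow_succ_apply_eq_bind]
    exact bind_potentialKernel_ne_zero hV hpos ih

lemma iterate_PhiHom_dirac [IsMarkovKernel κ] (hV : Measurable V) (hpos : ∀ x, 0 < V x) {b : ℝ}
    (hb : ∀ x, V x ≤ b) (n : ℕ) (x : E) :
    (PhiHom κ V)^[n] (Measure.dirac x) = normalize ((potentialKernel κ V hV ^ n) x) := by
  have := isFiniteKernel_potentialKernel (κ := κ) hV hb
  induction n with
  | zero =>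
    change _ = normalize (Kernel.id x)
    rw [Kernel.id_apply]
    simp [normalize]
  | succ n ih =>
    have := isFiniteKernel_pow (potentialKernel κ V hV) n
    rw [Function.iterate_succ_apply', ih, PhiHom_eq_normalize_bind hV,
      normalize.eq_def ((potentialKernel κ V hV ^ n) x), Measure.bind_smul, normalize_smul _ (by simp)
        (ENNReal.inv_ne_top.2 (by simpa using pow_potentialKernel_ne_zero hV hpos n x)),
      pow_succ_apply_eq_bind]

lemma integrable_of_abs_le {μ : Measure E} [IsFiniteMeasure μ] {f : E → ℝ} (hf : Measurable f)
    {b : ℝ} (hb : ∀ x, |f x| ≤ b) : Integrable f μ :=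
  Integrable.of_bound hf.aestronglyMeasurable b (Eventually.of_forall hb)

/-- Two probability measures that are uniformly close on measurable sets have close integrals. -/
lemma abs_integral_sub_le_of_nonneg {μ ν : Measure E} [IsProbabilityMeasure μ]
    [IsProbabilityMeasure ν] {ε : ℝ} (h : ∀ s, MeasurableSet s → |μ.real s - ν.real s| ≤ ε)
    {f : E → ℝ} (hf : Measurable f) {b : ℝ} (h0 : ∀ x, 0 ≤ f x) (hb : ∀ x, f x ≤ b) :
    |∫ x, f x ∂μ - ∫ x, f x ∂ν| ≤ ε * b := by
  obtain ⟨x⟩ : Nonempty E := nonempty_of_isProbabilityMeasure μ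
  have hb0 : 0 ≤ b := (h0 x).trans (hb x)
  have hint : ∀ ρ : Measure E, IsProbabilityMeasure ρ → Integrable f ρ := fun ρ _ =>
    integrable_of_abs_le hf fun x => by rw [abs_of_nonneg (h0 x)]; exact hb x
  have hanti : ∀ ρ : Measure E, IsProbabilityMeasure ρ →
      IntegrableOn (fun t => ρ.real {y | t ≤ f y}) (Set.Ioc 0 b) := fun ρ _ => by
    have : Antitone fun t => ρ.real {y | t ≤ f y} := fun s t hst =>
      measureReal_mono fun y (hy : t ≤ f y) => hst.trans hy
    exact (this.antitoneOn _ |>.integrableOn_isCompact isCompact_Icc).mono_set Set.Ioc_subset_Icc_self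
  rw [(hint μ ‹_›).integral_eq_integral_Ioc_meas_le (Eventually.of_forall h0)
      (Eventually.of_forall hb),
    (hint ν ‹_›).integral_eq_integral_Ioc_meas_le (Eventually.of_forall h0)
      (Eventually.of_forall hb),
    ← integral_sub (hanti μ ‹_›) (hanti ν ‹_›)]
  have := norm_setIntegral_le_of_norm_le_const (μ := volume) (s := Set.Ioc 0 b) (C := ε)
    (f := fun t => μ.real {y | t ≤ f y} - ν.real {y | t ≤ f y}) (by simp)
    fun t _ => h _ (measurableSet_le measurable_const hf)
  simpa [hb0] using this

lemma abs_integral_sub_le {μ ν : Measure E} [IsProbabilityMeasure μ]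
    [IsProbabilityMeasure ν] {ε : ℝ} (h : ∀ s, MeasurableSet s → |μ.real s - ν.real s| ≤ ε)
    {f : E → ℝ} (hf : Measurable f) {b : ℝ} (hb : ∀ x, |f x| ≤ b) :
    |∫ x, f x ∂μ - ∫ x, f x ∂ν| ≤ ε * (2 * b) := by
  have := abs_integral_sub_le_of_nonneg h (hf.add_const b) (b := 2 * b)
    (fun x => by linarith [(abs_le.1 (hb x)).1]) (fun x => by linarith [(abs_le.1 (hb x)).2])
  rw [integral_add (integrable_of_abs_le hf hb) (integrable_const _),
    integral_add (integrable_of_abs_le hf hb) (integrable_const _)] at this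
  simpa using this

lemma abs_real_sub_le_one (μ ν : Measure E) [IsProbabilityMeasure μ] [IsProbabilityMeasure ν]
    (s : Set E) : |(μ s).toReal - (ν s).toReal| ≤ 1 := by
  have h1 : μ.real s ≤ 1 := measureReal_le_one
  have h2 : ν.real s ≤ 1 := measureReal_le_one
  have h3 : 0 ≤ μ.real s := measureReal_nonneg
  have h4 : 0 ≤ ν.real s := measureReal_nonneg
  simp only [measureReal_def] at *
  rw [abs_le]; constructor <;> linarith

lemma tvDist_le_one (μ ν : Measure E) [IsProbabilityMeasure μ] [IsProbabilityMeasure ν] :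
    tvDist μ ν ≤ 1 :=
  ciSup_le (abs_real_sub_le_one μ ν)

lemma tvDist_nonneg (μ ν : Measure E) : 0 ≤ tvDist μ ν :=
  Real.iSup_nonneg fun _ => abs_nonneg _

lemma abs_real_sub_le_tvDist (μ ν : Measure E) [IsProbabilityMeasure μ] [IsProbabilityMeasure ν]
    (s : Set E) : |μ.real s - ν.real s| ≤ tvDist μ ν :=
  le_ciSup (f := fun s : Set E => |(μ s).toReal - (ν s).toReal|)
    ⟨1, by rintro _ ⟨s, rfl⟩; exact abs_real_sub_le_one μ ν s⟩ s

lemma bind_pow_eq_smul {ρ : Kernel E E} {η : Measure E} {r : ENNReal} (h : η.bind ρ = r • η)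
    (n : ℕ) : η.bind (ρ ^ n) = r ^ n • η := by
  induction n with
  | zero =>
    change η.bind Kernel.id = _
    rw [pow_zero, one_smul]
    exact Measure.bind_dirac
  | succ n ih => rw [bind_pow_succ, ih, Measure.bind_smul, h, smul_smul, pow_succ]

lemma measurable_normalize (ρ : Kernel E E) : Measurable fun x => normalize (ρ x) := by
  refine Measure.measurable_of_measurable_coe _ fun s hs => ?_
  simp only [normalize, Measure.smul_apply, smul_eq_mul]
  exact (ρ.measurable_coe MeasurableSet.univ).inv.mul (ρ.measurable_coe hs)

/-- If `η ρ = r η`, then `η` is the image under the normalized kernel of a reweighting of `η`. -/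
lemma exists_isProbabilityMeasure_bind_normalize_eq {ρ : Kernel E E} [IsFiniteKernel ρ]
    (hρ : ∀ x, ρ x ≠ 0) {η : Measure E} [IsProbabilityMeasure η] {r : ENNReal} (hr0 : r ≠ 0)
    (hr : r ≠ ⊤) (h : η.bind ρ = r • η) :
    ∃ μ : Measure E, IsProbabilityMeasure μ ∧ μ.bind (fun x => normalize (ρ x)) = η := by
  have hm : Measurable fun x => ρ x Set.univ := ρ.measurable_coe MeasurableSet.univ
  have happ : ∀ s, MeasurableSet s → ∫⁻ x, ρ x s ∂η = r * η s := fun s hs => by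
    rw [← Measure.bind_apply hs ρ.measurable.aemeasurable, h, Measure.smul_apply, smul_eq_mul]
  refine ⟨r⁻¹ • η.withDensity fun x => ρ x Set.univ, ⟨?_⟩, ?_⟩
  · rw [Measure.smul_apply, withDensity_apply _ MeasurableSet.univ, setLIntegral_univ,
      happ _ MeasurableSet.univ, measure_univ, mul_one, smul_eq_mul, ENNReal.inv_mul_cancel hr0 hr]
  · ext s hs
    rw [Measure.bind_smul, Measure.smul_apply,
      Measure.bind_apply hs (measurable_normalize ρ).aemeasurable,
      lintegral_withDensity_eq_lintegral_mul _ hm (g := fun x => normalize (ρ x) s)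
        ((Measure.measurable_coe hs).comp (measurable_normalize ρ))]
    have : ∀ x, ((fun x => ρ x Set.univ) * fun x => normalize (ρ x) s) x = ρ x s := fun x => by
      simp only [Pi.mul_apply, normalize, Measure.smul_apply, smul_eq_mul]
      rw [← mul_assoc, ENNReal.mul_inv_cancel (by simpa using hρ x) (measure_ne_top _ _), one_mul]
    rw [lintegral_congr this, happ s hs, smul_eq_mul, ← mul_assoc, ENNReal.inv_mul_cancel hr0 hr,
      one_mul]


lemma integral_bind (ρ : Kernel E E) [IsFiniteKernel ρ] (μ : Measure E) [IsFiniteMeasure μ]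
    {f : E → ℝ} (hf : Measurable f) {b : ℝ} (hb : ∀ x, |f x| ≤ b) :
    ∫ x, f x ∂(μ.bind ρ) = ∫ x, ∫ z, f z ∂(ρ x) ∂μ := by
  have h : (ρ ∘ₖ Kernel.const Unit μ) () = μ.bind ρ := by
    rw [Kernel.comp_apply, Kernel.const_apply]
  rw [← h, Kernel.integral_comp (integrable_of_abs_le hf hb), Kernel.const_apply]

lemma abs_log_sub_log_le {m u v : ℝ} (hm : 0 < m) (hu : m ≤ u) (hv : m ≤ v) :
    |Real.log u - Real.log v| ≤ |u - v| / m := by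
  have key : ∀ s t : ℝ, m ≤ s → m ≤ t → Real.log s - Real.log t ≤ |s - t| / m := by
    intro s t hs ht
    have hs0 := hm.trans_le hs
    have ht0 := hm.trans_le ht
    calc Real.log s - Real.log t = Real.log (s / t) := (Real.log_div hs0.ne' ht0.ne').symm
      _ ≤ s / t - 1 := Real.log_le_sub_one_of_pos (div_pos hs0 ht0)
      _ = (s - t) / t := by field_simp
      _ ≤ |s - t| / t := by gcongr; exact le_abs_self _
      _ ≤ |s - t| / m := by gcongr
  refine abs_le.2 ⟨?_, key u v hu hv⟩
  have := key v u hv hu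
  rw [abs_sub_comm] at this
  linarith

/-- The total mass of `ρ ^ n` at `x`, rescaled by `c ^ n`. -/
def scaledMass (ρ : Kernel E E) (c : ℝ) (n : ℕ) (x : E) : ℝ :=
  ((ρ ^ n) x).real Set.univ / c ^ n

lemma measurable_scaledMass (ρ : Kernel E E) (c : ℝ) (n : ℕ) : Measurable (scaledMass ρ c n) :=
  ((ρ ^ n).measurable_coe MeasurableSet.univ).ennreal_toReal.div_const _

lemma integral_scaledMass (ρ : Kernel E E) [IsFiniteKernel ρ] (c : ℝ) (n : ℕ) (μ : Measure E) :
    ∫ x, scaledMass ρ c n x ∂μ = (μ.bind (ρ ^ n)).real Set.univ / c ^ n := by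
  have := isFiniteKernel_pow ρ n
  simp only [scaledMass, measureReal_def]
  rw [integral_div, integral_toReal ((ρ ^ n).measurable_coe MeasurableSet.univ).aemeasurable
    (Eventually.of_forall fun x => measure_lt_top _ _),
    Measure.bind_apply MeasurableSet.univ (ρ ^ n).measurable.aemeasurable]

lemma integral_scaledMass_of_bind_eq_smul (ρ : Kernel E E) [IsFiniteKernel ρ] {c : ℝ} (hc : 0 < c)
    {η : Measure E} [IsProbabilityMeasure η] (hη : η.bind ρ = ENNReal.ofReal c • η) (n : ℕ) :
    ∫ x, scaledMass ρ c n x ∂η = 1 := by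
  rw [integral_scaledMass, bind_pow_eq_smul hη, ← ENNReal.ofReal_pow hc.le, measureReal_def,
    Measure.smul_apply, smul_eq_mul, measure_univ, mul_one, ENNReal.toReal_ofReal (by positivity),
    div_self (by positivity)]

lemma integral_scaledMass_apply (ρ : Kernel E E) [IsFiniteKernel ρ] {c : ℝ} (hc : 0 < c) (n : ℕ)
    (x : E) : ∫ z, scaledMass ρ c n z ∂(ρ x) = c * scaledMass ρ c (n + 1) x := by
  rw [integral_scaledMass, ← pow_succ_apply_eq_bind_pow, scaledMass]
  field_simp
  ring

lemma scaledMass_succ [IsMarkovKernel κ] (hV : Measurable V) (hpos : ∀ x, 0 < V x) {b : ℝ}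
    (hb : ∀ x, V x ≤ b) (c : ℝ) (n : ℕ) (x : E) :
    scaledMass (potentialKernel κ V hV) c (n + 1) x = scaledMass (potentialKernel κ V hV) c n x *
      ((∫ z, V z ∂(normalize ((potentialKernel κ V hV ^ n) x))) / c) := by
  have := isFiniteKernel_potentialKernel (κ := κ) hV hb
  have := isFiniteKernel_pow (potentialKernel κ V hV) n
  have h0 : ((potentialKernel κ V hV ^ n) x).real Set.univ ≠ 0 := by
    rw [measureReal_ne_zero_iff]
    simpa using pow_potentialKernel_ne_zero hV hpos n x
  have h1 : ((potentialKernel κ V hV ^ (n + 1)) x).real Set.univ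
      = ∫ z, V z ∂((potentialKernel κ V hV ^ n) x) := by
    rw [measureReal_def, pow_succ_apply_eq_bind, bind_potentialKernel_univ,
      integral_eq_lintegral_of_nonneg_ae (Eventually.of_forall fun z => (hpos z).le)
        hV.aestronglyMeasurable]
  rw [scaledMass, scaledMass, integral_normalize, h1, pow_succ]
  field_simp

lemma scaledMass_eq_exp_sum [IsMarkovKernel κ] (hV : Measurable V) (hpos : ∀ x, 0 < V x) {b m : ℝ}
    (hb : ∀ x, V x ≤ b) (hm : 0 < m) {c : ℝ} (hc : 0 < c) (x : E)
    (hint : ∀ n, m ≤ ∫ z, V z ∂(normalize ((potentialKernel κ V hV ^ n) x))) (n : ℕ) :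
    scaledMass (potentialKernel κ V hV) c n x = Real.exp (∑ k ∈ Finset.range n,
      (Real.log (∫ z, V z ∂(normalize ((potentialKernel κ V hV ^ k) x))) - Real.log c)) := by
  induction n with
  | zero =>
    have : ((potentialKernel κ V hV ^ 0) x).real Set.univ = 1 := by
      change (Kernel.id x).real Set.univ = 1
      rw [Kernel.id_apply]; exact probReal_univ
    rw [scaledMass, this]
    simp
  | succ n ih =>
    rw [scaledMass_succ hV hpos hb, ih, Finset.sum_range_succ, Real.exp_add, Real.exp_sub,
      Real.exp_log (hm.trans_le (hint n)), Real.exp_log hc]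

lemma le_integral_of_le {μ : Measure E} [IsProbabilityMeasure μ] (hV : Measurable V) {b m : ℝ}
    (hb : ∀ x, |V x| ≤ b) (hm : ∀ x, m ≤ V x) : m ≤ ∫ z, V z ∂μ := by
  have := integral_mono (μ := μ) (integrable_const m) (integrable_of_abs_le hV hb) hm
  simpa using this

lemma summable_mul_exp_neg_mul (A : ℝ) {r : ℝ} (hr : 0 < r) :
    Summable fun n : ℕ => A * Real.exp (-r * n) := by
  refine Summable.mul_left A ?_
  have := Real.summable_exp_nat_mul_iff.2 (neg_lt_zero.2 hr)
  simpa only [mul_comm] using this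

lemma tendsto_integral_of_summable {μ : ℕ → Measure E} {η : Measure E}
    [∀ n, IsProbabilityMeasure (μ n)] [IsProbabilityMeasure η] {ε : ℕ → ℝ} (hε : Summable ε)
    (h : ∀ n s, MeasurableSet s → |(μ n).real s - η.real s| ≤ ε n) {f : E → ℝ} (hf : Measurable f)
    {b : ℝ} (hb : ∀ x, |f x| ≤ b) :
    Tendsto (fun n => ∫ x, f x ∂(μ n)) atTop (nhds (∫ x, f x ∂η)) := by
  have h0 := (hε.mul_right (2 * b)).tendsto_atTop_zero
  rw [tendsto_iff_norm_sub_tendsto_zero]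
  exact squeeze_zero (fun _ => norm_nonneg _) (fun n => abs_integral_sub_le (h n) hf hb) h0

/-- Iterates of an eigenfunction of a finite kernel. -/
lemma integral_pow_of_eigenfunction (ρ : Kernel E E) [IsFiniteKernel ρ] {f : E → ℝ}
    (hf : Measurable f) {b : ℝ} (hb : ∀ x, |f x| ≤ b) {ζ : ℝ}
    (h : ∀ x, ∫ z, f z ∂(ρ x) = ζ * f x) (n : ℕ) (x : E) :
    ∫ z, f z ∂((ρ ^ n) x) = ζ ^ n * f x := by
  induction n with
  | zero =>
    change ∫ z, f z ∂(Kernel.id x) = _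
    rw [Kernel.id_apply, integral_dirac' _ _ hf.stronglyMeasurable, pow_zero, one_mul]
  | succ n ih =>
    have := isFiniteKernel_pow ρ n
    rw [pow_succ_apply_eq_bind, integral_bind ρ _ hf hb]
    simp_rw [h]
    rw [integral_const_mul, ih, pow_succ]
    ring

/-- The eigenvalue of an eigenfunction with nonzero mean under an eigenmeasure. -/
lemma eigenvalue_eq_of_bind_eq_smul (ρ : Kernel E E) [IsFiniteKernel ρ] {f : E → ℝ}
    (hf : Measurable f) {b : ℝ} (hb : ∀ x, |f x| ≤ b) {ζ : ℝ}
    (h : ∀ x, ∫ z, f z ∂(ρ x) = ζ * f x) {c : ℝ} (hc : 0 < c) {η : Measure E}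
    [IsProbabilityMeasure η] (hη : η.bind ρ = ENNReal.ofReal c • η) (h1 : ∫ x, f x ∂η = 1) :
    ζ = c := by
  have h2 := integral_bind ρ η hf hb
  simp_rw [h] at h2
  rw [hη, integral_smul_measure, integral_const_mul, h1, ENNReal.toReal_ofReal hc.le] at h2
  simpa using h2.symm

lemma bind_potentialKernel_eq_smul [IsMarkovKernel κ] (hV : Measurable V) (hpos : ∀ x, 0 < V x)
    {b : ℝ} (hb : ∀ x, V x ≤ b) {η : Measure E} [IsProbabilityMeasure η]
    (hfix : PhiHom κ V η = η) :
    η.bind (potentialKernel κ V hV) = ENNReal.ofReal (∫ x, V x ∂η) • η := by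
  have hint : Integrable V η := integrable_of_abs_le hV fun x => by
    rw [abs_of_pos (hpos x)]; exact hb x
  rw [PhiHom_eq_normalize_bind hV, normalize, bind_potentialKernel_univ,
    ← ofReal_integral_eq_lintegral_ofReal hint (Eventually.of_forall fun x => (hpos x).le)] at hfix
  have hne : ENNReal.ofReal (∫ x, V x ∂η) ≠ 0 := by
    rw [ofReal_integral_eq_lintegral_ofReal hint (Eventually.of_forall fun x => (hpos x).le)]
    exact lintegral_ofReal_ne_zero hV hpos (IsProbabilityMeasure.ne_zero η)
  nth_rewrite 3 [← hfix]
  rw [smul_smul, ENNReal.mul_inv_cancel hne ENNReal.ofReal_ne_top, one_smul]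

end GroundState

/-- Corollary corollary:spectral: in the stationary time-homogeneous case,
(η_∞ Q(1), h) is the unique pair (ζ, f) with Q(f) = ζ f and η_∞(f) = 1,
where Q(f) = G · M(f). -/
theorem statement_7
    {E : Type*} [MeasurableSpace E] [Nonempty E]
    (M1 : Kernel E E) (hM : IsMarkovKernel M1)
    (G1 : E → ℝ) (hGmeas : Measurable G1)
    (g : ℝ) (hGpos : ∀ x, 0 < G1 x) (hH0 : ∀ x y, G1 x ≤ g * G1 y)
    (a lam : ℝ) (hlam : 0 < lam)
    (hH : ∀ p n : ℕ, p ≤ n → ∀ μ ν : Measure E, IsProbabilityMeasure μ →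
      IsProbabilityMeasure ν →
      tvDist (Measure.bind μ (PFK (fun _ => M1) (fun _ => G1) p n))
          (Measure.bind ν (PFK (fun _ => M1) (fun _ => G1) p n)) ≤
        a * Real.exp (-lam * ((n : ℝ) - p)) * tvDist μ ν)
    (ηinf : Measure E) (hηinf : IsProbabilityMeasure ηinf)
    (hfix : PhiHom M1 G1 ηinf = ηinf)
    (huniq : ∀ μ : Measure E, IsProbabilityMeasure μ → PhiHom M1 G1 μ = μ → μ = ηinf) :
    (∫ x, hHom M1 G1 ηinf x ∂ηinf) = 1 ∧
    (∀ x : E, G1 x * ∫ z, hHom M1 G1 ηinf z ∂(M1 x) =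
      (∫ y, G1 y * ∫ z, (1 : ℝ) ∂(M1 y) ∂ηinf) * hHom M1 G1 ηinf x) ∧
    (∀ (ζ : ℝ) (f : E → ℝ), Measurable f → (∃ C, ∀ x, |f x| ≤ C) →
      (∀ x : E, G1 x * ∫ z, f z ∂(M1 x) = ζ * f x) →
      (∫ x, f x ∂ηinf) = 1 →
      ζ = (∫ y, G1 y * ∫ z, (1 : ℝ) ∂(M1 y) ∂ηinf) ∧ f = hHom M1 G1 ηinf) := by
  obtain ⟨x₀⟩ := ‹Nonempty E›
  have hg : 0 < g := by
    by_contra hg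
    nlinarith [hGpos x₀, hH0 x₀ x₀]
  obtain ⟨b, hb⟩ : ∃ b, ∀ x, G1 x ≤ b := ⟨g * G1 x₀, fun x => hH0 x x₀⟩
  obtain ⟨m, hm, hmG⟩ : ∃ m, 0 < m ∧ ∀ x, m ≤ G1 x :=
    ⟨G1 x₀ / g, div_pos (hGpos x₀) hg, fun x => (div_le_iff₀' hg).2 (hH0 x₀ x)⟩
  have habs : ∀ x, |G1 x| ≤ b := fun x => by rw [abs_of_pos (hGpos x)]; exact hb x
  set c := ∫ y, G1 y ∂ηinf with hc_def
  have hc : 0 < c := hm.trans_le (le_integral_of_le hGmeas habs hmG)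
  set K := potentialKernel M1 G1 hGmeas
  have hKfin : IsFiniteKernel K := isFiniteKernel_potentialKernel hGmeas hb
  have hKpow : ∀ n, IsFiniteKernel (K ^ n) := isFiniteKernel_pow K
  have hKne : ∀ n x, (K ^ n) x ≠ 0 := pow_potentialKernel_ne_zero hGmeas hGpos
  have hη : ηinf.bind K = ENNReal.ofReal c • ηinf :=
    bind_potentialKernel_eq_smul hGmeas hGpos hb hfix
  have hP : ∀ n x, IsProbabilityMeasure (normalize ((K ^ n) x)) := fun n x =>
    isProbabilityMeasure_normalize (hKne n x)
  have hKint : ∀ (f : E → ℝ) x, ∫ z, f z ∂(K x) = G1 x * ∫ z, f z ∂(M1 x) :=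
    integral_potentialKernel hGmeas hGpos
  have hcon : ∀ x (n : ℕ) s, MeasurableSet s →
      |(normalize ((K ^ n) x)).real s - ηinf.real s| ≤ |a| * Real.exp (-lam * n) := by
    intro x n s _
    obtain ⟨μ, hμ, hμη⟩ := exists_isProbabilityMeasure_bind_normalize_eq (hKne n)
      (pow_ne_zero n (ENNReal.ofReal_pos.2 hc).ne') (ENNReal.pow_ne_top ENNReal.ofReal_ne_top)
      (bind_pow_eq_smul hη n)
    have h := hH 0 n n.zero_le (Measure.dirac x) μ inferInstance hμ
    have hPFK : PFK (fun _ => M1) (fun _ => G1) 0 n = fun y => normalize ((K ^ n) y) :=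
      funext fun y => PFK_const_eq_normalize_pow hGmeas n y
    rw [hPFK, hμη, Measure.dirac_bind (measurable_normalize (K ^ n)), Nat.cast_zero, sub_zero] at h
    calc |(normalize ((K ^ n) x)).real s - ηinf.real s|
        ≤ tvDist (normalize ((K ^ n) x)) ηinf := abs_real_sub_le_tvDist _ _ s
      _ ≤ a * Real.exp (-lam * n) * tvDist (Measure.dirac x) μ := h
      _ ≤ |a| * Real.exp (-lam * n) * 1 := by
        gcongr
        · exact tvDist_nonneg _ _
        · exact le_abs_self a
        · exact tvDist_le_one _ _
      _ = _ := mul_one _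
  let B : ℕ → ℝ := fun n => |a| * Real.exp (-lam * n) * (2 * b) / m
  have hε : Summable fun n : ℕ => |a| * Real.exp (-lam * n) := summable_mul_exp_neg_mul _ hlam
  have hB : Summable B := (hε.mul_right (2 * b)).div_const m
  have hmint : ∀ x n, m ≤ ∫ z, G1 z ∂(normalize ((K ^ n) x)) := fun x n =>
    le_integral_of_le hGmeas habs hmG
  have hterm : ∀ x n, |Real.log (∫ z, G1 z ∂(normalize ((K ^ n) x))) - Real.log c| ≤ B n :=
    fun x n => (abs_log_sub_log_le hm (hmint x n) (le_integral_of_le hGmeas habs hmG)).trans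
      (div_le_div_of_nonneg_right (abs_integral_sub_le (hcon x n) hGmeas habs) hm.le)
  have hexp : ∀ x n, scaledMass K c n x = Real.exp (∑ k ∈ Finset.range n,
      (Real.log (∫ z, G1 z ∂(normalize ((K ^ k) x))) - Real.log c)) := fun x =>
    scaledMass_eq_exp_sum hGmeas hGpos hb hm hc x (hmint x)
  have hlim : ∀ x, Tendsto (fun n => scaledMass K c n x) atTop (nhds (hHom M1 G1 ηinf x)) := by
    intro x
    simp_rw [hexp x, hHom, Function.iterate_fixed hfix, iterate_PhiHom_dirac hGmeas hGpos hb]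
    exact (Real.continuous_exp.tendsto _).comp
      (Summable.of_norm_bounded hB (hterm x)).hasSum.tendsto_sum_nat
  have hbound : ∀ n x, ‖scaledMass K c n x‖ ≤ Real.exp (∑' k, B k) := by
    intro n x
    rw [hexp, Real.norm_of_nonneg (Real.exp_pos _).le]
    gcongr
    exact (Finset.sum_le_sum fun k _ => (le_abs_self _).trans (hterm x k)).trans
      (hB.sum_le_tsum _ fun k _ => (abs_nonneg _).trans (hterm x k))
  have hdct : ∀ μ : Measure E, IsFiniteMeasure μ → Tendsto (fun n => ∫ x, scaledMass K c n x ∂μ)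
      atTop (nhds (∫ x, hHom M1 G1 ηinf x ∂μ)) := fun μ _ =>
    tendsto_integral_of_dominated_convergence (fun _ => Real.exp (∑' k, B k))
      (fun n => (measurable_scaledMass K c n).aestronglyMeasurable) (integrable_const _)
      (fun n => Eventually.of_forall (hbound n)) (Eventually.of_forall hlim)
  have hc1 : ∫ y, G1 y * ∫ z, (1 : ℝ) ∂(M1 y) ∂ηinf = c := by simp [hc_def]
  rw [hc1]
  refine ⟨?_, fun x => ?_, fun ζ f hf ⟨C, hC⟩ hQf hf1 => ?_⟩
  · refine tendsto_nhds_unique (hdct ηinf inferInstance) ?_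
    simp_rw [integral_scaledMass_of_bind_eq_smul K hc hη]
    exact tendsto_const_nhds
  · rw [← hKint]
    refine tendsto_nhds_unique (hdct (K x) inferInstance) ?_
    simp_rw [integral_scaledMass_apply K hc]
    exact ((hlim x).comp (tendsto_add_atTop_nat 1)).const_mul c
  · simp_rw [← hKint] at hQf
    obtain rfl : ζ = c := eigenvalue_eq_of_bind_eq_smul K hf hC hQf hc hη hf1
    refine ⟨rfl, funext fun x => ?_⟩
    have hfx : ∀ n, f x = scaledMass K c n x * ∫ z, f z ∂(normalize ((K ^ n) x)) := fun n => by
      have h0 : ((K ^ n) x).real Set.univ ≠ 0 := by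
        rw [measureReal_ne_zero_iff]
        simpa using hKne n x
      rw [integral_normalize, integral_pow_of_eigenfunction K hf hC hQf, scaledMass]
      field_simp
    have h := (hlim x).mul (tendsto_integral_of_summable hε (hcon x) hf hC)
    rw [hf1, mul_one] at h
    exact tendsto_nhds_unique (tendsto_const_nhds.congr hfx) h

end FKCLT
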